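/- arXiv:2305.05123 — 2 statements merged into one kernel-verified Lean document; each statement's English description precedes it below -/
import Mathlib

section
/- Let dim H ≥ 3 and let φ: P(H) → P(H) satisfy ‖φ(P) − φ(Q)‖ ≤ ‖P − Q‖ for all P, Q ∈ P(H). Let {Q_α : α ∈ J} ⊆ P(H) be an OSP such that {φ(Q_α) : α ∈ J} is a COSP, let e_α be a unit vector spanning the range of φ(Q_α) for each α, let K be the closed linear span of the ranges of the Q_α, and let Φ be the map associated with the orthonormal basis {e_α : α ∈ J}. Then one of the following holds: (i) K = H and φ is a Wigner symmetry; (ii) there are a bijective linear isometry U: K → H and a unitary operator V: H → H that is diagonal with respect to {e_α} such that φ(P) = V Φ(U P U*) V* for all P ∈ P(K), where P(K) is identified with the rank-one projections on H whose range lies in K. -/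
open scoped InnerProductSpace ComplexConjugate

variable {H : Type*} [NormedAddCommGroup H] [InnerProductSpace ℂ H] [CompleteSpace H]

/-- The rank-one (orthogonal) projection onto the span of a unit vector `v`,
i.e. `x ↦ ⟪v, x⟫ • v`. -/
noncomputable def rankOneProj (v : H) : H →L[ℂ] H :=
  (innerSL ℂ v).smulRight v

/-- A rank-one projection: a self-adjoint idempotent bounded operator with
one-dimensional range. -/
def IsRankOneProjection (P : H →L[ℂ] H) : Prop :=
  IsSelfAdjoint P ∧ P ∘L P = P ∧ Module.finrank ℂ (LinearMap.range (P : H →ₗ[ℂ] H)) = 1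

/-- Given a Hilbert basis `b = {e_α}` and a vector `v = Σ c_α e_α`, the associated vector
`Σ |c_α| e_α`.  The map `Φ` associated with `b` sends the rank-one projection onto `ℂ v`
(for a unit vector `v`) to the rank-one projection onto `ℂ (absVec b v)`. -/
noncomputable def absVec {ι : Type*} (b : HilbertBasis ι ℂ H) (v : H) : H :=
  b.repr.symm ⟨fun α => (‖b.repr v α‖ : ℂ), by
    apply memℓp_gen
    have h := ((b.repr v).property).summable
      (by norm_num : (0 : ℝ) < (2 : ENNReal).toReal)
    refine h.congr fun α => ?_
    simp [Complex.norm_real]⟩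

/-- `φ` is a Wigner symmetry: there is a unitary or antiunitary operator `U` on `H`
(an additive, norm-preserving, surjective map that is `ℂ`-linear or conjugate-linear)
such that `φ P = U P U*` for every rank-one projection `P`; equivalently, `φ` sends the
projection onto `ℂv` to the projection onto `ℂ(Uv)` for every unit vector `v`. -/
def IsWignerSymmetry
    (φ : {P : H →L[ℂ] H // IsRankOneProjection P} → {P : H →L[ℂ] H // IsRankOneProjection P}) :
    Prop :=
  ∃ U : H → H,
    (∀ x y, U (x + y) = U x + U y) ∧
    (∀ x, ‖U x‖ = ‖x‖) ∧
    Function.Surjective U ∧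
    ((∀ (c : ℂ) (x : H), U (c • x) = c • U x) ∨
      (∀ (c : ℂ) (x : H), U (c • x) = (starRingEnd ℂ) c • U x)) ∧
    (∀ (v : H), ‖v‖ = 1 → ∀ P : {P : H →L[ℂ] H // IsRankOneProjection P},
      P.1 = rankOneProj v → (φ P).1 = rankOneProj (U v))

omit [CompleteSpace H] in
@[simp]
lemma rankOneProj_apply (v x : H) : rankOneProj v x = ⟪v, x⟫_ℂ • v := by
  simp [rankOneProj]

omit [CompleteSpace H] in
lemma rankOneProj_smul {c : ℂ} (hc : ‖c‖ = 1) (v : H) :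
    rankOneProj (c • v) = rankOneProj v := by
  ext x
  have h : conj c * c = 1 := by rw [Complex.conj_mul', hc]; norm_num
  simp only [rankOneProj_apply, inner_smul_left, smul_smul]
  rw [mul_right_comm, h, one_mul]

lemma isSelfAdjoint_rankOneProj (v : H) : IsSelfAdjoint (rankOneProj v) :=
  (InnerProductSpace.isPositive_rankOne_self (𝕜 := ℂ) v).isSelfAdjoint

omit [CompleteSpace H] in
lemma range_rankOneProj {v : H} (hv : ‖v‖ = 1) :
    LinearMap.range (rankOneProj v : H →ₗ[ℂ] H) = ℂ ∙ v := by
  ext x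
  rw [LinearMap.mem_range, Submodule.mem_span_singleton]
  constructor
  · rintro ⟨y, rfl⟩
    exact ⟨⟪v, y⟫_ℂ, by simp⟩
  · rintro ⟨c, rfl⟩
    exact ⟨c • v, by simp [inner_self_eq_norm_sq_to_K, hv]⟩

lemma isRankOneProjection_rankOneProj {v : H} (hv : ‖v‖ = 1) :
    IsRankOneProjection (rankOneProj v) := by
  refine ⟨isSelfAdjoint_rankOneProj v, ?_, ?_⟩
  · ext x
    simp [inner_self_eq_norm_sq_to_K, hv]
  · rw [range_rankOneProj hv]
    exact finrank_span_singleton (by rintro rfl; simp at hv)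

lemma IsRankOneProjection.exists_eq_rankOneProj {P : H →L[ℂ] H} (hP : IsRankOneProjection P) :
    ∃ v : H, ‖v‖ = 1 ∧ P = rankOneProj v := by
  obtain ⟨hsa, hid, hr⟩ := hP
  obtain ⟨⟨w, y, hy⟩, hw0, hw⟩ := finrank_eq_one_iff'.1 hr
  have hw0' : w ≠ 0 := fun h => hw0 (Subtype.ext h)
  have hPw : P w = w := by
    rw [← hy]
    exact congrArg (fun T : H →L[ℂ] H => T y) hid
  have hnorm : ‖w‖ ≠ 0 := norm_ne_zero_iff.2 hw0'
  set v : H := (‖w‖⁻¹ : ℂ) • w with hv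
  have hv1 : ‖v‖ = 1 := by simp [hv, norm_smul, hnorm]
  have hPv : P v = v := by rw [hv, map_smul, hPw]
  refine ⟨v, hv1, ?_⟩
  ext x
  obtain ⟨c, hc⟩ := hw ⟨P x, x, rfl⟩
  have hc' : P x = (c * ‖w‖) • v := by
    have : c • w = P x := congrArg Subtype.val hc
    rw [← this, hv, smul_smul, mul_assoc, mul_inv_cancel₀ (by exact_mod_cast hnorm), mul_one]
  have hin : ⟪v, P x⟫_ℂ = ⟪v, x⟫_ℂ := by
    rw [← ContinuousLinearMap.adjoint_inner_left, ← ContinuousLinearMap.star_eq_adjoint,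
      hsa.star_eq, hPv]
  rw [rankOneProj_apply, ← hin, hc', inner_smul_right, inner_self_eq_norm_sq_to_K, hv1]
  simp

omit [CompleteSpace H] in
lemma exists_smul_of_rankOneProj_eq {u v : H} (hu : ‖u‖ = 1) (hv : ‖v‖ = 1)
    (h : rankOneProj u = rankOneProj v) : ∃ c : ℂ, ‖c‖ = 1 ∧ u = c • v := by
  have h1 : u = ⟪v, u⟫_ℂ • v := by
    have := congrArg (fun T : H →L[ℂ] H => T u) h
    simpa [inner_self_eq_norm_sq_to_K, hu] using this
  refine ⟨⟪v, u⟫_ℂ, ?_, h1⟩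
  have h2 := congrArg norm h1
  rw [norm_smul, hu, hv, mul_one] at h2
  exact h2.symm

/-- The gap formula `‖P - Q‖² = 1 - |⟪u, v⟫|²` for rank-one projections. -/
lemma norm_rankOneProj_sub_sq {u v : H} (hu : ‖u‖ = 1) (hv : ‖v‖ = 1) :
    ‖rankOneProj u - rankOneProj v‖ ^ 2 = 1 - ‖⟪u, v⟫_ℂ‖ ^ 2 := by
  set D := rankOneProj u - rankOneProj v with hD
  set k : ℝ := 1 - ‖⟪u, v⟫_ℂ‖ ^ 2 with hk
  have hk0 : 0 ≤ k := by
    have := norm_inner_le_norm (𝕜 := ℂ) u v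
    rw [hu, hv] at this
    have := norm_nonneg ⟪u, v⟫_ℂ
    rw [hk]; nlinarith
  have hsa : IsSelfAdjoint D := (isSelfAdjoint_rankOneProj u).sub (isSelfAdjoint_rankOneProj v)
  have hcube : D * D * (D * D) = (k : ℂ) • (D * D) := by
    have hvu : ⟪v, u⟫_ℂ = conj ⟪u, v⟫_ℂ := (inner_conj_symm v u).symm
    have hkc : (k : ℂ) = 1 - ⟪u, v⟫_ℂ * conj ⟪u, v⟫_ℂ := by
      rw [Complex.mul_conj', hk]; push_cast; ring
    have huu : ⟪u, u⟫_ℂ = 1 := by simp [inner_self_eq_norm_sq_to_K, hu]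
    have hvv : ⟪v, v⟫_ℂ = 1 := by simp [inner_self_eq_norm_sq_to_K, hv]
    ext x
    simp only [hD, mul_apply_eq_comp, sub_apply,
      smul_apply, rankOneProj_apply, inner_sub_right, inner_smul_right,
      huu, hvv, hvu, hkc]
    module
  have hsa2 : IsSelfAdjoint (D * D) := by
    simpa [pow_two] using hsa.pow 2
  have h1 : ‖D * D‖ = ‖D‖ ^ 2 := hsa.norm_mul_self
  have h2 : ‖D * D * (D * D)‖ = ‖D * D‖ ^ 2 := hsa2.norm_mul_self
  rw [hcube, norm_smul, h1] at h2
  have h3 : ‖(k : ℂ)‖ = k := by rw [Complex.norm_real, Real.norm_of_nonneg hk0]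
  rw [h3] at h2
  by_cases h0 : ‖D‖ = 0
  · have : rankOneProj u = rankOneProj v := sub_eq_zero.1 (norm_eq_zero.1 h0)
    obtain ⟨c, hc, rfl⟩ := exists_smul_of_rankOneProj_eq hu hv this
    rw [h0, hk]
    simp [inner_self_eq_norm_sq_to_K, hv, hc]
  · have : ‖D‖ ^ 2 ≠ 0 := pow_ne_zero 2 h0
    exact mul_right_cancel₀ this (by rw [h2]; ring)

/-- A nonexpansive map on rank-one projections lifts to a norm-preserving map on vectors that
does not decrease the moduli of inner products. -/
lemma exists_vector_lift
    (φ : {P : H →L[ℂ] H // IsRankOneProjection P} → {P : H →L[ℂ] H // IsRankOneProjection P})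
    (hne : ∀ P Q : {P : H →L[ℂ] H // IsRankOneProjection P},
      ‖(φ P).1 - (φ Q).1‖ ≤ ‖P.1 - Q.1‖) :
    ∃ ψ : H → H, (∀ x, ‖ψ x‖ = ‖x‖) ∧ (∀ x y, ‖⟪x, y⟫_ℂ‖ ≤ ‖⟪ψ x, ψ y⟫_ℂ‖) ∧
      ∀ v, ‖v‖ = 1 → ∀ P : {P : H →L[ℂ] H // IsRankOneProjection P},
        P.1 = rankOneProj v → (φ P).1 = rankOneProj (ψ v) := by
  have key : ∀ v : H, ∃ w : H, ‖v‖ = 1 → ‖w‖ = 1 ∧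
      ∀ P : {P : H →L[ℂ] H // IsRankOneProjection P},
        P.1 = rankOneProj v → (φ P).1 = rankOneProj w := by
    intro v
    by_cases hv : ‖v‖ = 1
    · obtain ⟨w, hw, hw'⟩ :=
        (φ ⟨rankOneProj v, isRankOneProjection_rankOneProj hv⟩).2.exists_eq_rankOneProj
      refine ⟨w, fun _ => ⟨hw, fun P hP => ?_⟩⟩
      rw [← hw']
      congr 2
      exact Subtype.ext hP
    · exact ⟨0, fun h => absurd h hv⟩
  choose ρ hρ using key
  have hmono : ∀ u v : H, ‖u‖ = 1 → ‖v‖ = 1 → ‖⟪u, v⟫_ℂ‖ ≤ ‖⟪ρ u, ρ v⟫_ℂ‖ := by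
    intro u v hu hv
    have h := hne ⟨rankOneProj u, isRankOneProjection_rankOneProj hu⟩
      ⟨rankOneProj v, isRankOneProjection_rankOneProj hv⟩
    rw [(hρ u hu).2 _ rfl, (hρ v hv).2 _ rfl] at h
    have h2 := pow_le_pow_left₀ (norm_nonneg _) h 2
    rw [norm_rankOneProj_sub_sq (hρ u hu).1 (hρ v hv).1, norm_rankOneProj_sub_sq hu hv] at h2
    exact le_of_sq_le_sq (by linarith) (norm_nonneg _)
  have hunit : ∀ x : H, x ≠ 0 → ‖(‖x‖⁻¹ : ℂ) • x‖ = 1 := by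
    intro x hx
    simp [norm_smul, hx]
  refine ⟨fun x => (‖x‖ : ℂ) • ρ ((‖x‖⁻¹ : ℂ) • x), fun x => ?_, fun x y => ?_,
    fun v hv P hP => ?_⟩
  · by_cases hx : x = 0
    · simp [hx]
    · simp [norm_smul, (hρ _ (hunit x hx)).1]
  · by_cases hx : x = 0
    · simp [hx]
    by_cases hy : y = 0
    · simp [hy]
    have h := hmono _ _ (hunit x hx) (hunit y hy)
    have hx' : 0 < ‖x‖ := norm_pos_iff.2 hx
    have hy' : 0 < ‖y‖ := norm_pos_iff.2 hy
    simp only [inner_smul_left, inner_smul_right, norm_mul, map_inv₀, Complex.conj_ofReal,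
      norm_inv, Complex.norm_real, norm_norm] at h ⊢
    calc ‖⟪x, y⟫_ℂ‖ = ‖x‖ * (‖y‖ * (‖y‖⁻¹ * (‖x‖⁻¹ * ‖⟪x, y⟫_ℂ‖))) := by field_simp
      _ ≤ _ := by
        have h' : ‖y‖⁻¹ * (‖x‖⁻¹ * ‖⟪x, y⟫_ℂ‖) ≤
            ‖⟪ρ ((‖x‖⁻¹ : ℂ) • x), ρ ((‖y‖⁻¹ : ℂ) • y)⟫_ℂ‖ := by
          linarith
        refine (mul_le_mul_of_nonneg_left (mul_le_mul_of_nonneg_left h' hy'.le) hx'.le).trans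
          (le_of_eq (by ring))
  · simp only [hv]
    simpa using (hρ v hv).2 P hP

lemma Complex.eq_ofReal_of_norm_le_re {w : ℂ} {r : ℝ} (h : ‖w‖ = r) (hr : r ≤ w.re) :
    w = r := by
  have h1 : w.re ≤ ‖w‖ := Complex.re_le_norm w
  have h2 : w.re = r := le_antisymm (h ▸ h1) hr
  have h3 := Complex.sq_norm w
  rw [Complex.normSq_apply, h, h2] at h3
  have h4 : w.im = 0 := by
    have : w.im * w.im = 0 := by nlinarith
    exact mul_self_eq_zero.1 this
  exact Complex.ext (by simp [h2]) (by simp [h4])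

/-- A multiplicative self-map of the unit circle that does not decrease real parts is constant,
the identity, or complex conjugation. -/
lemma circle_hom_trichotomy (f : ℂ → ℂ) (hf : ∀ a, ‖a‖ = 1 → ‖f a‖ = 1)
    (hmul : ∀ a b, ‖a‖ = 1 → ‖b‖ = 1 → f (a * b) = f a * f b)
    (hre : ∀ a, ‖a‖ = 1 → a.re ≤ (f a).re) :
    (∀ a, ‖a‖ = 1 → f a = 1) ∨ (∀ a, ‖a‖ = 1 → f a = a) ∨
      (∀ a, ‖a‖ = 1 → f a = conj a) := by
  have hsq : ∀ a : ℂ, ‖a‖ = 1 → a.re ^ 2 + a.im ^ 2 = 1 := by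
    intro a ha
    have := Complex.sq_norm a
    rw [ha, Complex.normSq_apply] at this
    linarith
  have h1 : f 1 = 1 := by
    have h := hmul 1 1 (by simp) (by simp)
    have h0 : f 1 ≠ 0 := norm_ne_zero_iff.1 (by rw [hf 1 (by simp)]; norm_num)
    rw [one_mul] at h
    exact (mul_left_cancel₀ h0 (by rw [mul_one]; exact h)).symm
  have hneg : f (-1) = 1 ∨ f (-1) = -1 := by
    have h := hmul (-1) (-1) (by simp) (by simp)
    rw [neg_one_mul, neg_neg, h1] at h
    exact mul_self_eq_one_iff.1 h.symm
  have hfneg : ∀ a, ‖a‖ = 1 → f (-a) = f (-1) * f a := by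
    intro a ha
    rw [← hmul _ _ (by simp) ha, neg_one_mul]
  rcases hneg with hneg | hneg
  · left
    have hpos : ∀ a, ‖a‖ = 1 → 0 ≤ (f a).re := by
      intro a ha
      have h2 := hre a ha
      have h3 := hre (-a) (by simpa using ha)
      rw [hfneg a ha, hneg, one_mul, Complex.neg_re] at h3
      linarith
    have hiter : ∀ n : ℕ, ∀ a, ‖a‖ = 1 → 2 ^ n * (1 - (f a).re) ≤ 1 := by
      intro n
      induction n with
      | zero => intro a ha; have := hpos a ha; linarith
      | succ n ih =>
        intro a ha
        have h2 := ih (a * a) (by simp [ha])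
        rw [hmul a a ha ha, Complex.mul_re] at h2
        have h3 := hsq _ (hf a ha)
        have h4 := hpos a ha
        have h5 : (f a).re ≤ 1 := (Complex.re_le_norm _).trans (hf a ha).le
        have h6 : 2 * (1 - (f a).re) ≤
            1 - ((f a).re * (f a).re - (f a).im * (f a).im) := by nlinarith
        calc (2 : ℝ) ^ (n + 1) * (1 - (f a).re) = 2 ^ n * (2 * (1 - (f a).re)) := by ring
          _ ≤ _ := mul_le_mul_of_nonneg_left h6 (by positivity)
          _ ≤ 1 := h2
    intro a ha
    have h5 : 1 ≤ (f a).re := by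
      by_contra! hlt
      obtain ⟨n, hn⟩ := pow_unbounded_of_one_lt (1 / (1 - (f a).re)) (one_lt_two (α := ℝ))
      rw [div_lt_iff₀ (by linarith)] at hn
      exact absurd (hiter n a ha) (by linarith)
    simpa using Complex.eq_ofReal_of_norm_le_re (hf a ha) h5
  · right
    have hre' : ∀ a, ‖a‖ = 1 → (f a).re = a.re := by
      intro a ha
      have h2 := hre a ha
      have h3 := hre (-a) (by simpa using ha)
      rw [hfneg a ha, hneg, neg_one_mul, Complex.neg_re, Complex.neg_re] at h3
      linarith
    have hI : f Complex.I = Complex.I ∨ f Complex.I = -Complex.I := by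
      have h := hmul Complex.I Complex.I (by simp) (by simp)
      rw [Complex.I_mul_I, hneg] at h
      have h' : f Complex.I * f Complex.I = Complex.I * Complex.I := by
        rw [← h, Complex.I_mul_I]
      exact mul_self_eq_mul_self_iff.1 h'
    have him : ∀ a, ‖a‖ = 1 → (f Complex.I * f a).re = -a.im := by
      intro a ha
      rw [← hmul _ _ (by simp) ha, hre' _ (by simp [ha])]
      simp
    rcases hI with hI | hI
    · left
      intro a ha
      have h := him a ha
      rw [hI] at h
      exact Complex.ext (hre' a ha) (by simpa using h)
    · right
      intro a ha
      have h := him a ha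
      rw [hI] at h
      exact Complex.ext (by simpa using hre' a ha) (by simpa using h)

open scoped lp

section SequenceSpace

variable {J : Type*}

lemma lp.inner_eq_of_support {α β : J} (hαβ : α ≠ β) {w : ℓ²(J, ℂ)}
    (hw : ∀ γ, γ ≠ α → γ ≠ β → w γ = 0) (v : ℓ²(J, ℂ)) :
    ⟪w, v⟫_ℂ = conj (w α) * v α + conj (w β) * v β := by
  classical
  have h : w = lp.single 2 α (w α) + lp.single 2 β (w β) := by
    ext γ
    rw [lp.coeFn_add, Pi.add_apply, lp.single_apply, lp.single_apply]
    by_cases h1 : γ = α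
    · subst h1; simp [hαβ]
    by_cases h2 : γ = β
    · subst h2; simp [h1]
    simp [h1, h2, hw γ h1 h2]
  conv_lhs => rw [h]
  rw [inner_add_left, lp.inner_single_left, lp.inner_single_left]
  simp [mul_comm]

lemma lp.hasSum_norm_sq (v : ℓ²(J, ℂ)) : HasSum (fun α => ‖v α‖ ^ 2) (‖v‖ ^ 2) := by
  have h := lp.hasSum_norm (p := 2) (by norm_num) v
  simpa using h

/-- Two sequences with the same products `conj (y α) * y β` agree up to a phase. -/
lemma lp.exists_smul_of_conj_mul_eq {y y' : ℓ²(J, ℂ)}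
    (h : ∀ α β, conj (y α) * y β = conj (y' α) * y' β) : ∃ c : ℂ, ‖c‖ = 1 ∧ y = c • y' := by
  have hn : ∀ α, ‖y α‖ = ‖y' α‖ := by
    intro α
    have h1 := congrArg norm (h α α)
    simp only [norm_mul, RCLike.norm_conj] at h1
    exact (mul_self_inj (norm_nonneg _) (norm_nonneg _)).1 h1
  by_cases h0 : y' = 0
  · refine ⟨1, by simp, ?_⟩
    ext α
    have := hn α
    simpa [h0] using this
  · obtain ⟨α, hα⟩ : ∃ α, y' α ≠ 0 := by
      by_contra! hc
      exact h0 (lp.ext (funext hc))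
    have hα' : ‖y' α‖ ≠ 0 := norm_ne_zero_iff.2 hα
    have hyα : y α ≠ 0 := norm_ne_zero_iff.1 (by rwa [hn α])
    refine ⟨y α / y' α, by rw [norm_div, hn α, div_self hα'], ?_⟩
    ext β
    have hc : conj (y α) ≠ 0 := by simpa using hyα
    rw [lp.coeFn_smul, Pi.smul_apply, smul_eq_mul]
    apply mul_left_cancel₀ hc
    rw [h α β]
    have h2 := h α α
    field_simp
    linear_combination (-(y' β)) * h2

/-- A norm-preserving self-map of `ℓ²` decreasing neither moduli of inner products nor moduli of
coordinates. -/
structure IsPhaseLift (Ψ : ℓ²(J, ℂ) → ℓ²(J, ℂ)) : Prop where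
  norm_map : ∀ x, ‖Ψ x‖ = ‖x‖
  norm_inner_le : ∀ x y, ‖⟪x, y⟫_ℂ‖ ≤ ‖⟪Ψ x, Ψ y⟫_ℂ‖
  norm_le_norm_apply : ∀ α v, ‖v α‖ ≤ ‖Ψ v α‖

namespace IsPhaseLift

variable {Ψ : ℓ²(J, ℂ) → ℓ²(J, ℂ)} (hΨ : IsPhaseLift Ψ)
include hΨ

lemma norm_apply (v : ℓ²(J, ℂ)) (α : J) : ‖Ψ v α‖ = ‖v α‖ := by
  by_contra hne
  have hlt : ‖v α‖ < ‖Ψ v α‖ := lt_of_le_of_ne (hΨ.norm_le_norm_apply α v) (Ne.symm hne)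
  have h1 := lp.hasSum_norm_sq v
  have h2 := lp.hasSum_norm_sq (Ψ v)
  have h3 := hasSum_lt (i := α)
    (fun β => pow_le_pow_left₀ (norm_nonneg _) (hΨ.norm_le_norm_apply β v) 2)
    (pow_lt_pow_left₀ hlt (norm_nonneg _) two_ne_zero) h1 h2
  rw [hΨ.norm_map] at h3
  exact lt_irrefl _ h3

lemma apply_eq_zero {v : ℓ²(J, ℂ)} {α : J} (h : v α = 0) : Ψ v α = 0 :=
  norm_eq_zero.1 (by rw [hΨ.norm_apply, h, norm_zero])

lemma re_le_re {α β : J} (hαβ : α ≠ β) {w : ℓ²(J, ℂ)}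
    (hw : ∀ γ, γ ≠ α → γ ≠ β → w γ = 0) (v : ℓ²(J, ℂ)) :
    (conj (conj (w α) * w β) * (conj (v α) * v β)).re ≤
      (conj (conj (Ψ w α) * Ψ w β) * (conj (Ψ v α) * Ψ v β)).re := by
  have hw' : ∀ γ, γ ≠ α → γ ≠ β → Ψ w γ = 0 :=
    fun γ h1 h2 => hΨ.apply_eq_zero (hw γ h1 h2)
  have h := pow_le_pow_left₀ (norm_nonneg _) (hΨ.norm_inner_le w v) 2
  rw [lp.inner_eq_of_support hαβ hw, lp.inner_eq_of_support hαβ hw'] at h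
  have expand : ∀ a x d y : ℂ, ‖conj a * x + conj d * y‖ ^ 2 =
      (‖a‖ * ‖x‖) ^ 2 + (‖d‖ * ‖y‖) ^ 2 + 2 * (conj (conj a * d) * (conj x * y)).re := by
    intro a x d y
    rw [Complex.sq_norm, Complex.normSq_add, ← Complex.sq_norm, ← Complex.sq_norm, norm_mul,
      norm_mul, RCLike.norm_conj, RCLike.norm_conj, ← Complex.conj_re (conj a * x * _)]
    congr 3
    simp only [map_mul, Complex.conj_conj]
    ring
  rw [expand, expand, hΨ.norm_apply, hΨ.norm_apply, hΨ.norm_apply, hΨ.norm_apply] at h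
  linarith

end IsPhaseLift

/-- The vector `e_α + a e_β` of `ℓ²`. -/
noncomputable def pairVec [DecidableEq J] (α β : J) (a : ℂ) : ℓ²(J, ℂ) :=
  lp.single 2 α 1 + lp.single 2 β a

/-- The relative phase of the coordinates `α`, `β` of the image of `e_α + a e_β`. -/
noncomputable def relPhase [DecidableEq J] (Ψ : ℓ²(J, ℂ) → ℓ²(J, ℂ)) (α β : J) (a : ℂ) : ℂ :=
  conj (Ψ (pairVec α β a) α) * Ψ (pairVec α β a) β

section PairVec

variable [DecidableEq J] {α β : J}

lemma pairVec_left (h : α ≠ β) (a : ℂ) : pairVec α β a α = 1 := by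
  simp [pairVec, h]

lemma pairVec_right (h : α ≠ β) (a : ℂ) : pairVec α β a β = a := by
  simp [pairVec, h.symm]

lemma pairVec_of_ne {γ : J} (h1 : γ ≠ α) (h2 : γ ≠ β) (a : ℂ) : pairVec α β a γ = 0 := by
  simp [pairVec, h1, h2]

end PairVec

namespace IsPhaseLift

variable [DecidableEq J] {Ψ : ℓ²(J, ℂ) → ℓ²(J, ℂ)} (hΨ : IsPhaseLift Ψ)
include hΨ

lemma norm_relPhase {α β : J} (h : α ≠ β) {a : ℂ} (ha : ‖a‖ = 1) :
    ‖relPhase Ψ α β a‖ = 1 := by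
  rw [relPhase, norm_mul, RCLike.norm_conj, hΨ.norm_apply, hΨ.norm_apply, pairVec_left h,
    pairVec_right h, ha, norm_one, one_mul]

lemma conj_mul_eq {α β : J} (h : α ≠ β) {a : ℂ} (ha : ‖a‖ = 1) {r : ℝ} (hr : 0 ≤ r)
    {v : ℓ²(J, ℂ)} (hv : conj (v α) * v β = r * a) :
    conj (Ψ v α) * Ψ v β = r * relPhase Ψ α β a := by
  have haa : conj a * a = 1 := by rw [Complex.conj_mul', ha]; norm_num
  have hF := hΨ.norm_relPhase h ha
  have hFF : relPhase Ψ α β a * conj (relPhase Ψ α β a) = 1 := by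
    rw [Complex.mul_conj', hF]; norm_num
  have h1 := hΨ.re_le_re h (fun γ h1 h2 => pairVec_of_ne h1 h2 a) v
  rw [pairVec_left h, pairVec_right h, hv, map_one, one_mul] at h1
  have h2 : conj a * (r * a) = r := by linear_combination (r : ℂ) * haa
  rw [h2, Complex.ofReal_re] at h1
  have h3 : ‖conj (relPhase Ψ α β a) * (conj (Ψ v α) * Ψ v β)‖ = r := by
    have h4 := congrArg norm hv
    rw [norm_mul, norm_mul, RCLike.norm_conj, ha, mul_one, Complex.norm_real,
      Real.norm_of_nonneg hr] at h4
    rw [norm_mul, norm_mul, RCLike.norm_conj, RCLike.norm_conj, hF, hΨ.norm_apply,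
      hΨ.norm_apply, one_mul, h4]
  have h5 := Complex.eq_ofReal_of_norm_le_re h3 h1
  linear_combination (relPhase Ψ α β a) * h5 - (conj (Ψ v α) * Ψ v β) * hFF

lemma re_le_re_relPhase {α β : J} (h : α ≠ β) (a : ℂ) :
    a.re ≤ (conj (relPhase Ψ α β 1) * relPhase Ψ α β a).re := by
  have h1 := hΨ.re_le_re h (fun γ h1 h2 => pairVec_of_ne h1 h2 1) (pairVec α β a)
  rw [pairVec_left h, pairVec_right h, pairVec_left h, pairVec_right h, map_one, one_mul,
    one_mul, map_one, one_mul] at h1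
  exact h1

lemma relPhase_mul {α β γ : J} (hαβ : α ≠ β) (hβγ : β ≠ γ) (hαγ : α ≠ γ) {a d : ℂ}
    (ha : ‖a‖ = 1) (hd : ‖d‖ = 1) :
    relPhase Ψ α β a * relPhase Ψ β γ d = relPhase Ψ α γ (a * d) := by
  have haa : conj a * a = 1 := by rw [Complex.conj_mul', ha]; norm_num
  set v : ℓ²(J, ℂ) := lp.single 2 α 1 + lp.single 2 β a + lp.single 2 γ (a * d) with hv
  have hα : v α = 1 := by simp [hv, hαβ, hαγ]
  have hβ : v β = a := by simp [hv, hαβ.symm, hβγ]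
  have hγ : v γ = a * d := by simp [hv, hαγ.symm, hβγ.symm]
  have h1 := hΨ.conj_mul_eq (v := v) hαβ ha zero_le_one (by simp [hα, hβ])
  have h2 := hΨ.conj_mul_eq (v := v) hβγ hd zero_le_one (by
    rw [hβ, hγ]; push_cast; linear_combination d * haa)
  have h3 := hΨ.conj_mul_eq (v := v) hαγ (a := a * d) (by simp [ha, hd]) zero_le_one
    (by simp [hα, hγ])
  have h4 : Ψ v β * conj (Ψ v β) = 1 := by
    rw [Complex.mul_conj', hΨ.norm_apply, hβ, ha]; norm_num
  simp only [Complex.ofReal_one, one_mul] at h1 h2 h3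
  rw [← h1, ← h2, ← h3]
  linear_combination (conj (Ψ v α) * Ψ v γ) * h4

lemma relPhase_symm {α β : J} (h : α ≠ β) :
    relPhase Ψ β α 1 = conj (relPhase Ψ α β 1) := by
  have h1 := hΨ.conj_mul_eq (v := pairVec α β 1) h.symm (a := 1) (by simp) zero_le_one
    (by simp [pairVec_left h, pairVec_right h])
  rw [Complex.ofReal_one, one_mul] at h1
  rw [← h1, relPhase]
  simp [mul_comm]

/-- Relative phases split into a diagonal part and a single circle map. -/
lemma exists_relPhase_eq (hJ : 3 ≤ Cardinal.mk J) :
    ∃ (z : J → ℂ) (f : ℂ → ℂ), (∀ α, ‖z α‖ = 1) ∧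
      (∀ α β, α ≠ β → ∀ a, ‖a‖ = 1 → relPhase Ψ α β a = conj (z α) * z β * f a) ∧
      ((∀ a, ‖a‖ = 1 → f a = 1) ∨ (∀ a, ‖a‖ = 1 → f a = a) ∨
        (∀ a, ‖a‖ = 1 → f a = conj a)) := by
  have hthird := Cardinal.exists_ne_ne_of_three_le hJ
  obtain ⟨α₀⟩ : Nonempty J := by
    rw [← Cardinal.mk_ne_zero_iff]
    rintro h; rw [h] at hJ; simp at hJ
  obtain ⟨β₀, hβ₀, -⟩ := hthird α₀ α₀
  set g : J → J → ℂ → ℂ := fun α β a => conj (relPhase Ψ α β 1) * relPhase Ψ α β a with hg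
  have n1 : ‖(1 : ℂ)‖ = 1 := norm_one
  have hunit : ∀ {α β : J}, α ≠ β →
      relPhase Ψ α β 1 * conj (relPhase Ψ α β 1) = 1 := by
    intro α β h
    rw [Complex.mul_conj', hΨ.norm_relPhase h n1]; norm_num
  have hg1 : ∀ {α β : J}, α ≠ β → g α β 1 = 1 := by
    intro α β h
    exact (mul_comm _ _).trans (hunit h)
  have hgmul : ∀ {α β γ : J}, α ≠ β → β ≠ γ → α ≠ γ → ∀ {a d : ℂ}, ‖a‖ = 1 → ‖d‖ = 1 →
      g α β a * g β γ d = g α γ (a * d) := by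
    intro α β γ h1 h2 h3 a d ha hd
    have h4 := hΨ.relPhase_mul h1 h2 h3 ha hd
    have h5 := hΨ.relPhase_mul h1 h2 h3 n1 n1
    rw [mul_one] at h5
    simp only [hg]
    rw [← h4, ← h5, map_mul]
    ring
  have hright : ∀ {α β γ : J}, α ≠ β → α ≠ γ → ∀ {a : ℂ}, ‖a‖ = 1 → g α β a = g α γ a := by
    intro α β γ h1 h2 a ha
    by_cases h3 : β = γ
    · rw [h3]
    · have := hgmul h1 h3 h2 ha n1
      rwa [hg1 h3, mul_one, mul_one] at this
  have hleft : ∀ {α β γ : J}, α ≠ γ → β ≠ γ → ∀ {a : ℂ}, ‖a‖ = 1 → g α γ a = g β γ a := by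
    intro α β γ h1 h2 a ha
    by_cases h3 : α = β
    · rw [h3]
    · have := hgmul h3 h2 h1 n1 ha
      rw [hg1 h3, one_mul, one_mul] at this
      exact this.symm
  have hall : ∀ {α β : J}, α ≠ β → ∀ {a : ℂ}, ‖a‖ = 1 → g α β a = g α₀ β₀ a := by
    intro α β h a ha
    by_cases h1 : α = β₀
    · obtain ⟨γ, hγ1, hγ2⟩ := hthird α₀ β₀
      subst h1
      rw [hright h hγ2.symm ha, hleft (β := α₀) hγ2.symm hγ1.symm ha,
        hright hγ1.symm hβ₀.symm ha]
    · rw [hright h h1 ha, hleft h1 hβ₀.symm ha]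
  obtain ⟨γ, hγ1, hγ2⟩ := hthird α₀ β₀
  have htri := circle_hom_trichotomy (g α₀ β₀)
    (fun a ha => by
      simp only [hg, norm_mul, RCLike.norm_conj, hΨ.norm_relPhase hβ₀.symm ha,
        hΨ.norm_relPhase hβ₀.symm n1, one_mul])
    (fun a d ha hd => by
      rw [← hall hγ1.symm (by simp [ha, hd] : ‖a * d‖ = 1),
        ← hgmul hβ₀.symm hγ2.symm hγ1.symm ha hd, hall hγ2.symm hd])
    (fun a _ => hΨ.re_le_re_relPhase hβ₀.symm a)
  refine ⟨fun α => if α = α₀ then 1 else relPhase Ψ α₀ α 1, g α₀ β₀, fun α => ?_,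
    fun α β h a ha => ?_, htri⟩
  · by_cases h : α = α₀
    · simp [h]
    · simp only [h, if_false]
      exact hΨ.norm_relPhase (Ne.symm h) n1
  · have h1 : relPhase Ψ α β a = relPhase Ψ α β 1 * g α₀ β₀ a := by
      rw [← hall h ha, hg]
      linear_combination (-relPhase Ψ α β a) * hunit h
    have h2 : relPhase Ψ α β 1 = conj (if α = α₀ then 1 else relPhase Ψ α₀ α 1) *
        (if β = α₀ then 1 else relPhase Ψ α₀ β 1) := by
      by_cases h3 : α = α₀
      · subst h3
        simp [h.symm]
      · by_cases h4 : β = α₀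
        · subst h4
          simp [h, hΨ.relPhase_symm h.symm]
        · simp only [h3, h4, if_false]
          have h5 := hΨ.relPhase_mul (Ne.symm h3) h (Ne.symm h4) n1 n1
          rw [mul_one] at h5
          rw [← h5]
          linear_combination (-relPhase Ψ α β 1) * hunit (Ne.symm h3)
    rw [h1, h2]

/-- The structure theorem for phase lifts. -/
lemma trichotomy (hJ : 3 ≤ Cardinal.mk J) :
    ∃ z : J → ℂ, (∀ α, ‖z α‖ = 1) ∧
      ((∀ v y : ℓ²(J, ℂ), (∀ α, y α = z α * ‖v α‖) → ∃ c : ℂ, ‖c‖ = 1 ∧ Ψ v = c • y) ∨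
        (∀ v y : ℓ²(J, ℂ), (∀ α, y α = z α * v α) → ∃ c : ℂ, ‖c‖ = 1 ∧ Ψ v = c • y) ∨
        (∀ v y : ℓ²(J, ℂ), (∀ α, y α = z α * conj (v α)) →
          ∃ c : ℂ, ‖c‖ = 1 ∧ Ψ v = c • y)) := by
  obtain ⟨z, f, hz, hF, hf⟩ := hΨ.exists_relPhase_eq hJ
  have hdiag : ∀ v y : ℓ²(J, ℂ), (∀ α, ‖y α‖ = ‖v α‖) → ∀ α,
      conj (Ψ v α) * Ψ v α = conj (y α) * y α := by
    intro v y h α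
    rw [Complex.conj_mul', Complex.conj_mul', hΨ.norm_apply, h]
  have hoff : ∀ (v : ℓ²(J, ℂ)) (α β : J), α ≠ β → ∃ a : ℂ, ‖a‖ = 1 ∧
      conj (v α) * v β = (‖v α‖ * ‖v β‖) * a ∧
      conj (Ψ v α) * Ψ v β = (‖v α‖ * ‖v β‖) * (conj (z α) * z β * f a) := by
    intro v α β h
    obtain ⟨a, ha, hva⟩ : ∃ a : ℂ, ‖a‖ = 1 ∧
        conj (v α) * v β = ((‖v α‖ * ‖v β‖ : ℝ) : ℂ) * a := by
      by_cases h0 : conj (v α) * v β = 0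
      · refine ⟨1, by simp, ?_⟩
        have := congrArg norm h0
        rw [norm_mul, RCLike.norm_conj, norm_zero] at this
        rw [h0, this]; simp
      · have hn : ‖conj (v α) * v β‖ = ‖v α‖ * ‖v β‖ := by rw [norm_mul, RCLike.norm_conj]
        have hn0 : ‖conj (v α) * v β‖ ≠ 0 := norm_ne_zero_iff.2 h0
        refine ⟨conj (v α) * v β / (‖conj (v α) * v β‖ : ℂ), ?_, ?_⟩
        · rw [norm_div, Complex.norm_real, norm_norm, div_self hn0]
        · rw [← hn, mul_div_cancel₀ _ (by exact_mod_cast hn0)]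
    have h1 := hΨ.conj_mul_eq h ha (by positivity) hva
    rw [hF α β h a ha] at h1
    push_cast at hva h1
    exact ⟨a, ha, hva, h1⟩
  refine ⟨z, hz, ?_⟩
  rcases hf with hf | hf | hf
  · refine Or.inl fun v y hy => lp.exists_smul_of_conj_mul_eq fun α β => ?_
    by_cases h : α = β
    · subst h
      exact hdiag v y (fun γ => by simp [hy γ, hz γ]) α
    · obtain ⟨a, ha, -, h2⟩ := hoff v α β h
      rw [h2, hf a ha, hy, hy, map_mul, Complex.conj_ofReal]
      ring
  · refine Or.inr (Or.inl fun v y hy => lp.exists_smul_of_conj_mul_eq fun α β => ?_)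
    by_cases h : α = β
    · subst h
      exact hdiag v y (fun γ => by simp [hy γ, hz γ]) α
    · obtain ⟨a, ha, h1, h2⟩ := hoff v α β h
      rw [h2, hf a ha, hy, hy, map_mul]
      linear_combination (-(conj (z α) * z β)) * h1
  · refine Or.inr (Or.inr fun v y hy => lp.exists_smul_of_conj_mul_eq fun α β => ?_)
    by_cases h : α = β
    · subst h
      exact hdiag v y (fun γ => by simp [hy γ, hz γ]) α
    · obtain ⟨a, ha, h1, h2⟩ := hoff v α β h
      have h3 := congrArg conj h1
      simp only [map_mul, Complex.conj_conj, Complex.conj_ofReal] at h3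
      rw [h2, hf a ha, hy, hy, map_mul, Complex.conj_conj]
      linear_combination (-(conj (z α) * z β)) * h3

end IsPhaseLift

end SequenceSpace

section Assembly

variable {J : Type*}

omit [CompleteSpace H] in
lemma HilbertBasis.three_le_mk (b : HilbertBasis J ℂ H) (hdim : 3 ≤ Module.rank ℂ H) :
    3 ≤ Cardinal.mk J := by
  cases finite_or_infinite J with
  | inl hfin =>
    have := Fintype.ofFinite J
    have h := b.toOrthonormalBasis.toBasis.mk_eq_rank
    rw [← Cardinal.lift_le.{_, _}] at hdim
    rw [← h] at hdim
    simpa using hdim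
  | inr hinf =>
    exact (Cardinal.natCast_lt_aleph0 (n := 3)).le.trans (Cardinal.aleph0_le_mk J)

lemma HilbertBasis.exists_diagonal (b : HilbertBasis J ℂ H) {z : J → ℂ}
    (hz : ∀ α, ‖z α‖ = 1) :
    ∃ V : H ≃ₗᵢ[ℂ] H, (∀ α, V (b α) = z α • b α) ∧
      ∀ x α, b.repr (V x) α = z α * b.repr x α := by
  classical
  have hzz : ∀ α, z α * conj (z α) = 1 := by
    intro α
    rw [Complex.mul_conj', hz]; norm_num
  have hz0 : ∀ α, z α ≠ 0 := fun α => norm_ne_zero_iff.1 (by rw [hz]; norm_num)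
  have horth : Orthonormal ℂ fun α => z α • b α := by
    refine ⟨fun α => by rw [norm_smul, hz, b.orthonormal.1, one_mul], fun α β h => ?_⟩
    simp only [inner_smul_left, inner_smul_right, b.orthonormal.2 h, mul_zero]
  have hbot : (Submodule.span ℂ (Set.range fun α => z α • b α))ᗮ = ⊥ := by
    rw [Submodule.eq_bot_iff]
    intro x hx
    have h0 : ∀ α, b.repr x α = 0 := by
      intro α
      have h1 := (Submodule.mem_orthogonal _ _).1 hx _ (Submodule.subset_span ⟨α, rfl⟩)
      simp only [inner_smul_left] at h1
      rw [b.repr_apply_apply]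
      exact (mul_eq_zero.1 h1).resolve_left (by simpa using hz0 α)
    exact b.repr.map_eq_zero_iff.1 (lp.ext (funext h0))
  set b' := HilbertBasis.mkOfOrthogonalEqBot horth hbot with hb'
  have hb'c : ∀ α, b' α = z α • b α := by
    intro α
    rw [hb', HilbertBasis.coe_mkOfOrthogonalEqBot]
  refine ⟨b.repr.trans b'.repr.symm, fun α => ?_, fun x α => ?_⟩
  · rw [LinearIsometryEquiv.trans_apply, b.repr_self, b'.repr_symm_single, hb'c]
  · set y := (b.repr.trans b'.repr.symm) x with hy
    have h1 : b.repr x = b'.repr y := by simp [hy]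
    rw [h1, b'.repr_apply_apply, b.repr_apply_apply, hb'c, inner_smul_left, ← mul_assoc, hzz,
      one_mul]

lemma lp.inner_star_star (x y : ℓ²(J, ℂ)) : ⟪star x, star y⟫_ℂ = conj ⟪x, y⟫_ℂ := by
  refine (lp.hasSum_inner (𝕜 := ℂ) (star x) (star y)).unique ?_
  have h := Complex.hasSum_conj'.2 (lp.hasSum_inner (𝕜 := ℂ) x y)
  have hfun : (fun α => ⟪star x α, star y α⟫_ℂ) = fun α => conj ⟪x α, y α⟫_ℂ := by
    funext α
    simp [mul_comm]
  rwa [hfun]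

omit [CompleteSpace H] in
lemma smul_eq_smul_of_orthogonal {r u : H}
    (h : ∀ s : H, ⟪s, u⟫_ℂ = 0 → ⟪s, r⟫_ℂ = 0) :
    ⟪u, u⟫_ℂ • r = ⟪u, r⟫_ℂ • u := by
  set s := ⟪u, u⟫_ℂ • r - ⟪u, r⟫_ℂ • u with hs
  have h1 : ⟪s, u⟫_ℂ = 0 := by
    rw [hs, inner_sub_left, inner_smul_left, inner_smul_left, inner_conj_symm, inner_conj_symm]
    ring
  have h2 : ⟪s, s⟫_ℂ = 0 := by
    nth_rw 2 [hs]
    rw [inner_sub_right, inner_smul_right, inner_smul_right, h s h1, h1, mul_zero, mul_zero, sub_zero]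
  exact sub_eq_zero.1 (inner_self_eq_zero.1 h2)

omit [CompleteSpace H] in
/-- If a map not decreasing moduli of inner products restricts, up to phases, to a surjective
transition-probability preserving map on `K`, then `K` is the whole space. -/
lemma eq_top_of_lift {K : Submodule ℂ H} [CompleteSpace K] {ψ : H → H}
    (hψ : ∀ x y, ‖⟪x, y⟫_ℂ‖ ≤ ‖⟪ψ x, ψ y⟫_ℂ‖) {W : K → H} (hsurj : Function.Surjective W)
    (hinner : ∀ x y, ‖⟪W x, W y⟫_ℂ‖ = ‖⟪x, y⟫_ℂ‖)
    (hW : ∀ v : K, ∃ c : ℂ, ‖c‖ = 1 ∧ ψ v = c • W v)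
    {r₁ r₂ : K} (hr₁ : r₁ ≠ 0) (hr₂ : r₂ ≠ 0) (hr : ⟪r₁, r₂⟫_ℂ = 0) : K = ⊤ := by
  rw [← Submodule.orthogonal_eq_bot_iff, Submodule.eq_bot_iff]
  intro p hp
  by_contra hp0
  have hpK : ∀ s : K, ⟪(s : H), p⟫_ℂ = 0 := fun s => (Submodule.mem_orthogonal _ _).1 hp s s.2
  have hpK' : ∀ s : K, ⟪p, (s : H)⟫_ℂ = 0 := fun s => inner_eq_zero_symm.1 (hpK s)
  have key : ∀ r : K, r ≠ 0 → ∃ (u : K) (a : ℂ), W u = ψ (p + r) ∧ u = a • r := by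
    intro r hr0
    obtain ⟨u, hu⟩ := hsurj (ψ (p + r))
    have h1 : ⟪u, u⟫_ℂ • r = ⟪u, r⟫_ℂ • u := by
      refine smul_eq_smul_of_orthogonal fun s hs => ?_
      obtain ⟨c, hc, hsc⟩ := hW s
      have h2 := hψ s (p + r)
      rw [inner_add_right, hpK, zero_add, hsc, ← hu, inner_smul_left, norm_mul, RCLike.norm_conj,
        hc, one_mul, hinner, hs, norm_zero] at h2
      exact norm_le_zero_iff.1 h2
    have hu0 : u ≠ 0 := by
      rintro rfl
      have h2 := hψ (p + r) (p + r)
      rw [← hu, hinner, inner_zero_left, norm_zero, norm_le_zero_iff, inner_self_eq_zero] at h2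
      have h3 := hpK' r
      rw [← neg_eq_of_add_eq_zero_right h2, inner_neg_right, neg_eq_zero,
        inner_self_eq_zero] at h3
      exact hp0 h3
    have huu : ⟪u, u⟫_ℂ ≠ 0 := inner_self_ne_zero.2 hu0
    have hur : ⟪u, r⟫_ℂ ≠ 0 := by
      intro h0
      rw [h0, zero_smul] at h1
      exact (smul_ne_zero huu hr0) h1
    refine ⟨u, (⟪u, r⟫_ℂ)⁻¹ * ⟪u, u⟫_ℂ, hu, ?_⟩
    rw [mul_smul, h1, smul_smul, inv_mul_cancel₀ hur, one_smul]
  obtain ⟨u₁, a₁, hu₁, rfl⟩ := key r₁ hr₁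
  obtain ⟨u₂, a₂, hu₂, rfl⟩ := key r₂ hr₂
  have h1 := hψ (p + r₁) (p + r₂)
  rw [← hu₁, ← hu₂, hinner, inner_smul_left, inner_smul_right, hr, mul_zero, mul_zero, norm_zero,
    inner_add_left, inner_add_right, inner_add_right, hpK, hpK', ← Submodule.coe_inner, hr,
    add_zero, add_zero, add_zero, norm_le_zero_iff, inner_self_eq_zero] at h1
  exact hp0 h1

lemma isWignerSymmetry_of_lift {K : Submodule ℂ H} (hK : K = ⊤)
    {φ : {P : H →L[ℂ] H // IsRankOneProjection P} → {P : H →L[ℂ] H // IsRankOneProjection P}}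
    {ψ : H → H}
    (hφ : ∀ v, ‖v‖ = 1 → ∀ P : {P : H →L[ℂ] H // IsRankOneProjection P},
      P.1 = rankOneProj v → (φ P).1 = rankOneProj (ψ v))
    {W : K → H} (hadd : ∀ x y, W (x + y) = W x + W y) (hnorm : ∀ x, ‖W x‖ = ‖x‖)
    (hsurj : Function.Surjective W)
    (hsmul : (∀ (c : ℂ) x, W (c • x) = c • W x) ∨ (∀ (c : ℂ) x, W (c • x) = conj c • W x))
    (hW : ∀ v : K, ∃ c : ℂ, ‖c‖ = 1 ∧ ψ v = c • W v) : IsWignerSymmetry φ := by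
  have hmem : ∀ x : H, x ∈ K := fun x => hK ▸ Submodule.mem_top
  refine ⟨fun x => W ⟨x, hmem x⟩, fun x y => hadd ⟨x, hmem x⟩ ⟨y, hmem y⟩,
    fun x => hnorm ⟨x, hmem x⟩, fun y => ?_, ?_, fun v hv P hP => ?_⟩
  · obtain ⟨x, hx⟩ := hsurj y
    exact ⟨x, hx⟩
  · exact hsmul.imp (fun h c x => h c ⟨x, hmem x⟩) (fun h c x => h c ⟨x, hmem x⟩)
  · obtain ⟨c, hc, h⟩ := hW ⟨v, hmem v⟩
    rw [hφ v hv P hP, h, rankOneProj_smul hc]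

omit [CompleteSpace H] in
/-- An orthonormal family is a Hilbert basis of its closed linear span. -/
lemma Orthonormal.exists_hilbertBasis_closure_span {q : J → H} (hq : Orthonormal ℂ q)
    {K : Submodule ℂ H} [CompleteSpace K]
    (hK : K = (Submodule.span ℂ (Set.range q)).topologicalClosure) :
    ∃ b : HilbertBasis J ℂ K, ∀ α, (b α : H) = q α := by
  have hmem : ∀ α, q α ∈ K := fun α =>
    hK ▸ Submodule.le_topologicalClosure _ (Submodule.subset_span ⟨α, rfl⟩)
  have horth : Orthonormal ℂ fun α => (⟨q α, hmem α⟩ : K) :=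
    ⟨fun α => hq.1 α, fun α β h => hq.2 h⟩
  have hbot : (Submodule.span ℂ (Set.range fun α => (⟨q α, hmem α⟩ : K)))ᗮ = ⊥ := by
    rw [Submodule.eq_bot_iff]
    intro x hx
    have h1 : (x : H) ∈ (Submodule.span ℂ (Set.range q))ᗮ := by
      rw [Submodule.mem_orthogonal]
      intro u hu
      induction hu using Submodule.span_induction with
      | mem u hu =>
        obtain ⟨α, rfl⟩ := hu
        exact (Submodule.mem_orthogonal _ _).1 hx _ (Submodule.subset_span ⟨α, rfl⟩)
      | zero => exact inner_zero_left _
      | add u v _ _ hu hv => rw [inner_add_left, hu, hv, add_zero]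
      | smul c u _ hu => rw [inner_smul_left, hu, mul_zero]
    rw [← Submodule.orthogonal_closure, ← hK] at h1
    exact Subtype.ext (inner_self_eq_zero.1 ((Submodule.mem_orthogonal _ _).1 h1 x x.2))
  exact ⟨HilbertBasis.mkOfOrthogonalEqBot horth hbot, fun α => by
    rw [HilbertBasis.coe_mkOfOrthogonalEqBot]⟩

end Assembly

/-- Proposition 3.3.  Assume `dim H ≥ 3` and let `φ` be nonexpansive on
the set of rank-one projections.  Let `{Q_α : α ∈ J}` be an OSP such that `{φ(Q_α)}` is a
COSP, say `φ(Q_α)` is the projection onto the span of the unit vector `b α`, where `b` is the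
orthonormal basis of `H` so obtained.  Let `K` be the closed linear span of the ranges of the
`Q_α` and `Φ` the map associated with `b`.  Then either `K = H` and `φ` is a Wigner symmetry,
or there are a bijective linear isometry `U : K → H` and a unitary `V` diagonal with respect
to `b` such that `φ(P) = V Φ(U P U*) V*` for all rank-one projections `P` with range in
`K`. -/
theorem nonexpansive_image_contains_COSP_dichotomy
    (hdim : 3 ≤ Module.rank ℂ H)
    (φ : {P : H →L[ℂ] H // IsRankOneProjection P} → {P : H →L[ℂ] H // IsRankOneProjection P})
    (hne : ∀ P Q : {P : H →L[ℂ] H // IsRankOneProjection P},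
      ‖(φ P).1 - (φ Q).1‖ ≤ ‖P.1 - Q.1‖)
    {J : Type*} (Q : J → {P : H →L[ℂ] H // IsRankOneProjection P})
    (hOSP : ∀ α β, α ≠ β → (Q α).1 ∘L (Q β).1 = 0)
    (b : HilbertBasis J ℂ H)
    (hb : ∀ α, (φ (Q α)).1 = rankOneProj (b α))
    (K : Submodule ℂ H)
    (hK : K = (⨆ α, LinearMap.range ((Q α).1 : H →ₗ[ℂ] H)).topologicalClosure) :
    (K = ⊤ ∧ IsWignerSymmetry φ) ∨
      ∃ (U : K ≃ₗᵢ[ℂ] H) (V : H ≃ₗᵢ[ℂ] H) (z : J → ℂ),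
        (∀ α, ‖z α‖ = 1) ∧ (∀ α, V (b α) = z α • b α) ∧
        ∀ (P : {P : H →L[ℂ] H // IsRankOneProjection P}) (v : K), ‖(v : H)‖ = 1 →
          P.1 = rankOneProj (v : H) →
            ∀ x : H, (φ P).1 (V x) = V (rankOneProj (absVec b (U v)) x) := by
  classical
  obtain ⟨ψ, hψnorm, hψinner, hφ⟩ := exists_vector_lift φ hne
  choose q hq1 hQ using fun α => (Q α).2.exists_eq_rankOneProj
  have hqorth : Orthonormal ℂ q := by
    refine ⟨hq1, fun α β h => ?_⟩
    have h1 := congrArg (fun T : H →L[ℂ] H => T (q β)) (hOSP α β h)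
    simp only [hQ, ContinuousLinearMap.comp_apply, rankOneProj_apply,
      inner_self_eq_norm_sq_to_K, hq1, inner_smul_right, zero_apply] at h1
    have hqα : q α ≠ 0 := norm_ne_zero_iff.1 (by rw [hq1]; norm_num)
    simpa [hqα] using h1
  have hKspan : K = (Submodule.span ℂ (Set.range q)).topologicalClosure := by
    rw [hK, Submodule.span_range_eq_iSup]
    simp only [hQ, range_rankOneProj (hq1 _)]
  have : CompleteSpace K := by
    rw [hK]
    exact (Submodule.isClosed_topologicalClosure _).completeSpace_coe
  obtain ⟨e, he⟩ := hqorth.exists_hilbertBasis_closure_span hKspan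
  have hJ := b.three_le_mk hdim
  set Ψ : ℓ²(J, ℂ) → ℓ²(J, ℂ) := fun x => b.repr (ψ (e.repr.symm x : K)) with hΨdef
  have hΨ : IsPhaseLift Ψ := by
    refine ⟨fun x => ?_, fun x y => ?_, fun α v => ?_⟩
    · rw [hΨdef, LinearIsometryEquiv.norm_map, hψnorm, ← Submodule.coe_norm,
        LinearIsometryEquiv.norm_map]
    · have h := hψinner (e.repr.symm x : K) (e.repr.symm y : K)
      rw [← Submodule.coe_inner, LinearIsometryEquiv.inner_map_map] at h
      rwa [hΨdef, LinearIsometryEquiv.inner_map_map]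
    · obtain ⟨c, hc, hcb⟩ := exists_smul_of_rankOneProj_eq ((hψnorm _).trans (hq1 α))
        (b.orthonormal.1 α) ((hφ _ (hq1 α) _ (hQ α)).symm.trans (hb α))
      have h := hψinner (e α : K) (e.repr.symm v : K)
      rw [← Submodule.coe_inner, ← e.repr_apply_apply, LinearIsometryEquiv.apply_symm_apply, he,
        hcb, inner_smul_left, norm_mul, RCLike.norm_conj, hc, one_mul,
        ← b.repr_apply_apply] at h
      exact h
  obtain ⟨z, hz, htri⟩ := hΨ.trichotomy hJ
  obtain ⟨V, hVb, hV⟩ := b.exists_diagonal hz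
  have hback : ∀ (v : K) (y : H), (∃ c : ℂ, ‖c‖ = 1 ∧ Ψ (e.repr v) = c • b.repr y) →
      ∃ c : ℂ, ‖c‖ = 1 ∧ ψ v = c • y := by
    rintro v y ⟨c, hc, h⟩
    refine ⟨c, hc, b.repr.injective ?_⟩
    simp only [map_smul, ← h, hΨdef, LinearIsometryEquiv.symm_apply_apply]
  have hwigner : ∀ W : K → H, (∀ x y, W (x + y) = W x + W y) → (∀ x, ‖W x‖ = ‖x‖) →
      Function.Surjective W →
      ((∀ (c : ℂ) x, W (c • x) = c • W x) ∨ (∀ (c : ℂ) x, W (c • x) = conj c • W x)) →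
      (∀ x y, ‖⟪W x, W y⟫_ℂ‖ = ‖⟪x, y⟫_ℂ‖) →
      (∀ v : K, ∃ c : ℂ, ‖c‖ = 1 ∧ ψ v = c • W v) → K = ⊤ ∧ IsWignerSymmetry φ := by
    intro W hadd hnorm hsurj hsmul hinner hW
    obtain ⟨α⟩ : Nonempty J := by
      rw [← Cardinal.mk_ne_zero_iff]
      rintro h; rw [h] at hJ; simp at hJ
    obtain ⟨β, hβ, -⟩ := Cardinal.exists_ne_ne_of_three_le hJ α α
    have htop := eq_top_of_lift hψinner hsurj hinner hW (e.orthonormal.ne_zero α)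
      (e.orthonormal.ne_zero β) (e.orthonormal.2 hβ.symm)
    exact ⟨htop, isWignerSymmetry_of_lift htop hφ hadd hnorm hsurj hsmul hW⟩
  rcases htri with h | h | h
  · right
    refine ⟨e.repr.trans b.repr.symm, V, z, hz, hVb, fun P v hv hP x => ?_⟩
    obtain ⟨c, hc, hψv⟩ := hback v (V (absVec b ((e.repr.trans b.repr.symm) v)))
      (h _ _ fun α => by simp [hV, absVec])
    rw [hφ _ hv P hP, hψv, rankOneProj_smul hc, rankOneProj_apply, rankOneProj_apply,
      LinearIsometryEquiv.inner_map_map, map_smul]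
  · left
    refine hwigner (fun v => V (b.repr.symm (e.repr v))) (by simp) (by simp) ?_
      (Or.inl (by simp)) (by simp [LinearIsometryEquiv.inner_map_map])
      (fun v => hback v _ (h _ _ fun α => by simp [hV]))
    exact V.surjective.comp (b.repr.symm.surjective.comp e.repr.surjective)
  · left
    refine hwigner (fun v => V (b.repr.symm (star (e.repr v)))) (by simp) (by simp) ?_
      (Or.inr (by simp [star_smul])) (fun x y => ?_)
      (fun v => hback v _ (h _ _ fun α => by simp [hV]))
    · exact V.surjective.comp (b.repr.symm.surjective.comp
        (star_involutive.surjective.comp e.repr.surjective))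
    · rw [LinearIsometryEquiv.inner_map_map, LinearIsometryEquiv.inner_map_map,
        lp.inner_star_star, RCLike.norm_conj, LinearIsometryEquiv.inner_map_map]
end

section
/- Let x, y, z be unit vectors in a complex Hilbert space H. Then |⟨x, y⟩| ≤ |⟨x, z⟩|·|⟨y, z⟩| + √(1 − |⟨x, z⟩|²)·√(1 − |⟨y, z⟩|²). -/
open scoped InnerProductSpace ComplexConjugate

variable {H : Type*} [NormedAddCommGroup H] [InnerProductSpace ℂ H]

/-- The inner product of the components of `x` and `y` orthogonal to a unit vector `z`. -/
theorem inner_sub_inner_smul_sub_inner_smul (x y : H) {z : H} (hz : ‖z‖ = 1) :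
    ⟪x - ⟪z, x⟫_ℂ • z, y - ⟪z, y⟫_ℂ • z⟫_ℂ = ⟪x, y⟫_ℂ - ⟪x, z⟫_ℂ * ⟪z, y⟫_ℂ := by
  have hzz : ⟪z, z⟫_ℂ = 1 := inner_self_eq_one_of_norm_eq_one hz
  simp only [inner_sub_left, inner_sub_right, inner_smul_left, inner_smul_right, hzz,
    inner_conj_symm]
  ring

/-- The norm of the component of a unit vector `x` orthogonal to a unit vector `z`. -/
theorem norm_sub_inner_smul_of_norm_eq_one {x z : H} (hx : ‖x‖ = 1) (hz : ‖z‖ = 1) :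
    ‖x - ⟪z, x⟫_ℂ • z‖ = Real.sqrt (1 - ‖⟪x, z⟫_ℂ‖ ^ 2) := by
  have h := inner_sub_inner_smul_sub_inner_smul x x hz
  rw [inner_self_eq_norm_sq_to_K, inner_self_eq_norm_sq_to_K, hx, ← inner_conj_symm z x,
    RCLike.mul_conj] at h
  rw [← Real.sqrt_sq (norm_nonneg (x - _))]
  congr 1
  have h' : ((‖x - ⟪z, x⟫_ℂ • z‖ ^ 2 : ℝ) : ℂ) = ((1 - ‖⟪x, z⟫_ℂ‖ ^ 2 : ℝ) : ℂ) := by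
    simpa using h
  exact_mod_cast h'

/-- inequality (2.5) from the proof of Example 4.2. For unit vectors
`x, y, z` in a complex Hilbert space,
`|⟪x, y⟫| ≤ |⟪x, z⟫|·|⟪y, z⟫| + √(1 − |⟪x, z⟫|²)·√(1 − |⟪y, z⟫|²)`. -/
theorem abs_inner_le_of_unit_vectors
    (x y z : H) (hx : ‖x‖ = 1) (hy : ‖y‖ = 1) (hz : ‖z‖ = 1) :
    ‖⟪x, y⟫_ℂ‖ ≤ ‖⟪x, z⟫_ℂ‖ * ‖⟪y, z⟫_ℂ‖ +
      Real.sqrt (1 - ‖⟪x, z⟫_ℂ‖ ^ 2) * Real.sqrt (1 - ‖⟪y, z⟫_ℂ‖ ^ 2) := by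
  have h := norm_inner_le_norm (𝕜 := ℂ) (x - ⟪z, x⟫_ℂ • z) (y - ⟪z, y⟫_ℂ • z)
  rw [inner_sub_inner_smul_sub_inner_smul x y hz, norm_sub_inner_smul_of_norm_eq_one hx hz,
    norm_sub_inner_smul_of_norm_eq_one hy hz] at h
  have htri := norm_sub_norm_le ⟪x, y⟫_ℂ (⟪x, z⟫_ℂ * ⟪z, y⟫_ℂ)
  rw [norm_mul, norm_inner_symm z y] at htri
  linarith
end
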